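/- arXiv:2512.04236 — 2 statements merged into one kernel-verified Lean document; each statement's English description precedes it below -/
import Mathlib

section
/- Let T : [0,1] → [0,1] be the Gauss map, T(0) = 0 and T(x) = 1/x mod 1 for x ≠ 0. Then for every α ∈ (0, 1/2), the set {x ∈ [0,1] : liminf_{n→∞} |T^n x| > 0} is α-winning for Schmidt's game on [0,1]. -/
/-- Schmidt's `(α, β)`-game on a metric space `X`: Bob plays closed balls
`B(z k, r k)` with `r (k+1) = β * (α * r k)`, Alice (given the history of Bob's
moves so far) plays the center of a closed ball of radius `α * r k` which must be
contained in Bob's current ball, and Bob must play inside Alice's ball.  A set `S`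
is `(α, β)`-winning if Alice has a strategy whose moves are always legal and which
guarantees that `⋂ k, B(z k, r k)` meets `S`, for every legal play by Bob. -/
def SchmidtWinning {X : Type*} [MetricSpace X] (S : Set X) (α β : ℝ) : Prop :=
  ∃ strat : List (X × ℝ) → X,
    ∀ (z : ℕ → X) (r : ℕ → ℝ),
      0 < r 0 →
      (∀ k, r (k + 1) = β * (α * r k)) →
      (∀ k, Metric.closedBall (z (k + 1)) (r (k + 1)) ⊆
        Metric.closedBall (strat ((List.range (k + 1)).map fun i => (z i, r i)))
          (α * r k)) →
      (∀ k, Metric.closedBall (strat ((List.range (k + 1)).map fun i => (z i, r i)))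
          (α * r k) ⊆ Metric.closedBall (z k) (r k)) ∧
        ((⋂ k, Metric.closedBall (z k) (r k)) ∩ S).Nonempty

/-- Distinct fractions are at distance at least the reciprocal of the product of their
denominators. -/
lemma one_le_abs_sub_div_mul {p p' q q' : ℤ} (hq : 1 ≤ q) (hq' : 1 ≤ q')
    (hne : (p : ℝ) / q ≠ p' / q') :
    1 ≤ |(p : ℝ) / q - p' / q'| * (q * q') := by
  have h1 : (0 : ℝ) < q := by exact_mod_cast hq
  have h2 : (0 : ℝ) < q' := by exact_mod_cast hq'
  have hne' : p * q' - q * p' ≠ 0 := by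
    intro h
    apply hne
    rw [div_eq_div_iff h1.ne' h2.ne']
    have : ((p * q' - q * p' : ℤ) : ℝ) = 0 := by rw [h]; simp
    push_cast at this
    linarith
  have key : (1 : ℝ) ≤ |((p * q' - q * p' : ℤ) : ℝ)| := by
    exact_mod_cast Int.one_le_abs hne'
  rw [div_sub_div _ _ h1.ne' h2.ne', abs_div, abs_of_pos (mul_pos h1 h2),
    div_mul_cancel₀ _ (mul_pos h1 h2).ne']
  push_cast at key
  exact key

/-- Inside a ball of radius `r` of `[0,1]` there is a ball of radius `α * r` which stays at
distance `(1 - 2 * α) * r` from every fraction `p / q` with `8 * q ^ 2 * r ≤ 1`. -/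
lemma exists_closedBall_subset_far_from_fractions {α : ℝ} (hα : α ∈ Set.Ioo (0 : ℝ) (1 / 2))
    (z : Set.Icc (0 : ℝ) 1) (r : ℝ) (hr : 0 < r) :
    ∃ ζ : Set.Icc (0 : ℝ) 1, Metric.closedBall ζ (α * r) ⊆ Metric.closedBall z r ∧
      ∀ x ∈ Metric.closedBall ζ (α * r), ∀ p q : ℤ, 1 ≤ q → 8 * (q : ℝ) ^ 2 * r ≤ 1 →
        (1 - 2 * α) * r ≤ |(x : ℝ) - p / q| := by
  obtain ⟨hα0, hα1⟩ := hα
  obtain ⟨z, hz0, hz1⟩ := z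
  have unique : ∀ p q p' q' : ℤ, 1 ≤ q → 1 ≤ q' → 8 * (q : ℝ) ^ 2 * r ≤ 1 →
      8 * (q' : ℝ) ^ 2 * r ≤ 1 → |z - (p : ℝ) / q| ≤ 2 * r → |z - (p' : ℝ) / q'| ≤ 2 * r →
      (p : ℝ) / q = p' / q' := by
    intro p q p' q' hq hq' h h' hd hd'
    by_contra hne
    have key := one_le_abs_sub_div_mul hq hq' hne
    have hdist : |(p : ℝ) / q - p' / q'| ≤ 4 * r := by
      rw [abs_le] at *
      constructor <;> linarith
    have h1 : (1 : ℝ) ≤ q := by exact_mod_cast hq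
    have h2 : (1 : ℝ) ≤ q' := by exact_mod_cast hq'
    have hqq : (0 : ℝ) ≤ q * q' := by positivity
    have := mul_le_mul_of_nonneg_right hdist hqq
    nlinarith [mul_nonneg hr.le (sq_nonneg ((q : ℝ) - q'))]
  have hαr : 0 < α * r := mul_pos hα0 hr
  have hαr' : α * r < 1 / 2 * r := mul_lt_mul_of_pos_right hα1 hr
  by_cases hex : ∃ p q : ℤ, 1 ≤ q ∧ 8 * (q : ℝ) ^ 2 * r ≤ 1 ∧ |z - (p : ℝ) / q| ≤ 2 * r
  · obtain ⟨p, q, hq, hqr, hd⟩ := hex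
    have hr8 : 8 * r ≤ 1 := by
      have h1 : (1 : ℝ) ≤ q := by exact_mod_cast hq
      have h2 : (1 : ℝ) ≤ (q : ℝ) ^ 2 := one_le_pow₀ h1
      nlinarith
    have far : ∀ y : ℝ, |y - z| ≤ r → (1 - 2 * α) * r ≤ |y - p / q| →
        ∀ p' q' : ℤ, 1 ≤ q' → 8 * (q' : ℝ) ^ 2 * r ≤ 1 →
          (1 - 2 * α) * r ≤ |y - p' / q'| := by
      intro y hy hyw p' q' hq' h'
      by_cases hd' : |z - (p' : ℝ) / q'| ≤ 2 * r
      · rwa [← unique p q p' q' hq hq' hqr h' hd hd']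
      · push Not at hd'
        have := abs_sub_le z y (p' / q')
        rw [abs_sub_comm z y] at this
        linarith
    have right_side : (p : ℝ) / q ≤ z → z + r ≤ 1 →
        ∃ ζ : Set.Icc (0 : ℝ) 1,
          Metric.closedBall ζ (α * r) ⊆ Metric.closedBall ⟨z, hz0, hz1⟩ r ∧
          ∀ x ∈ Metric.closedBall ζ (α * r), ∀ p q : ℤ, 1 ≤ q → 8 * (q : ℝ) ^ 2 * r ≤ 1 →
            (1 - 2 * α) * r ≤ |(x : ℝ) - p / q| := by
      intro hw hzr
      refine ⟨⟨z + (1 - α) * r, by nlinarith, by nlinarith⟩, ?_⟩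
      have bounds : ∀ x ∈ Metric.closedBall
          (⟨z + (1 - α) * r, by nlinarith, by nlinarith⟩ : Set.Icc (0 : ℝ) 1) (α * r),
          |(x : ℝ) - z| ≤ r ∧ (1 - 2 * α) * r ≤ (x : ℝ) - z := by
        intro x hx
        rw [Metric.mem_closedBall, Subtype.dist_eq, Real.dist_eq, abs_le] at hx
        obtain ⟨h1, h2⟩ := hx
        rw [abs_le]
        refine ⟨⟨?_, ?_⟩, ?_⟩ <;> linarith
      refine ⟨fun x hx => ?_, fun x hx => far x (bounds x hx).1 ?_⟩
      · rw [Metric.mem_closedBall, Subtype.dist_eq, Real.dist_eq]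
        exact (bounds x hx).1
      · exact le_trans (by linarith [(bounds x hx).2]) (le_abs_self _)
    have left_side : z ≤ (p : ℝ) / q → 0 ≤ z - r →
        ∃ ζ : Set.Icc (0 : ℝ) 1,
          Metric.closedBall ζ (α * r) ⊆ Metric.closedBall ⟨z, hz0, hz1⟩ r ∧
          ∀ x ∈ Metric.closedBall ζ (α * r), ∀ p q : ℤ, 1 ≤ q → 8 * (q : ℝ) ^ 2 * r ≤ 1 →
            (1 - 2 * α) * r ≤ |(x : ℝ) - p / q| := by
      intro hw hzr
      refine ⟨⟨z - (1 - α) * r, by nlinarith, by nlinarith⟩, ?_⟩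
      have bounds : ∀ x ∈ Metric.closedBall
          (⟨z - (1 - α) * r, by nlinarith, by nlinarith⟩ : Set.Icc (0 : ℝ) 1) (α * r),
          |(x : ℝ) - z| ≤ r ∧ (1 - 2 * α) * r ≤ z - (x : ℝ) := by
        intro x hx
        rw [Metric.mem_closedBall, Subtype.dist_eq, Real.dist_eq, abs_le] at hx
        obtain ⟨h1, h2⟩ := hx
        rw [abs_le]
        refine ⟨⟨?_, ?_⟩, ?_⟩ <;> linarith
      refine ⟨fun x hx => ?_, fun x hx => far x (bounds x hx).1 ?_⟩
      · rw [Metric.mem_closedBall, Subtype.dist_eq, Real.dist_eq]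
        exact (bounds x hx).1
      · exact le_trans (by linarith [(bounds x hx).2]) (neg_le_abs _)
    rcases le_or_gt ((p : ℝ) / q) z with hw | hw
    · by_cases hzr : z + r ≤ 1
      · exact right_side hw hzr
      · have h1 : (p : ℝ) / q = (1 : ℤ) / (1 : ℤ) := by
          refine unique p q 1 1 hq le_rfl hqr ?_ hd ?_
          · norm_num; linarith
          · rw [abs_le]; norm_num; constructor <;> linarith
        norm_num at h1
        exact left_side (by linarith) (by linarith)
    · by_cases hzr : 0 ≤ z - r
      · exact left_side hw.le hzr
      · have h1 : (p : ℝ) / q = (0 : ℤ) / (1 : ℤ) := by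
          refine unique p q 0 1 hq le_rfl hqr ?_ hd ?_
          · norm_num; linarith
          · rw [abs_le]; norm_num; constructor <;> linarith
        simp only [Int.cast_zero, zero_div] at h1
        linarith
  · push Not at hex
    refine ⟨⟨z, hz0, hz1⟩, Metric.closedBall_subset_closedBall (by linarith), ?_⟩
    intro x hx p q hq hqr
    rw [Metric.mem_closedBall, Subtype.dist_eq, Real.dist_eq] at hx
    have h1 := hex p q hq hqr
    have h2 := abs_sub_le z x ((p : ℝ) / q)
    rw [abs_sub_comm z x] at h2
    simp only at hx
    linarith

/-- If `x` is badly approximable with constant `c`, then its whole orbit under the Gauss map is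
bounded below by `c`. -/
lemma le_gaussMap_iterate (T : Set.Icc (0 : ℝ) 1 → Set.Icc (0 : ℝ) 1)
    (hT : ∀ x : Set.Icc (0 : ℝ) 1,
      ((T x : ℝ)) = if (x : ℝ) = 0 then 0 else Int.fract (1 / (x : ℝ)))
    {c : ℝ} (hc : 0 < c) (x : Set.Icc (0 : ℝ) 1)
    (hx : ∀ p q : ℤ, 1 ≤ q → c / (q : ℝ) ^ 2 ≤ |(x : ℝ) - p / q|) (n : ℕ) :
    c ≤ (T^[n] x : ℝ) := by
  have lower : ∀ (t : Set.Icc (0 : ℝ) 1) (p q p' q' : ℤ), 1 ≤ q → 0 ≤ q' →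
      |p' * q - p * q'| = 1 → (x : ℝ) * (q + q' * t) = p + p' * t → c ≤ (t : ℝ) := by
    intro t p q p' q' hq hq' hdet heq
    have ht := t.2.1
    have h1 : (1 : ℝ) ≤ q := by exact_mod_cast hq
    have h2 : (0 : ℝ) ≤ q' := by exact_mod_cast hq'
    have h3 : (0 : ℝ) ≤ q' * t := mul_nonneg h2 ht
    have hdet' : |(p' * q - p * q' : ℝ)| = 1 := by exact_mod_cast hdet
    have hpos : (0 : ℝ) < q * (q + q' * t) := by positivity
    have hsub : (x : ℝ) - p / q = (p' * q - p * q') * t / (q * (q + q' * t)) := by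
      rw [eq_div_iff hpos.ne']
      field_simp
      linear_combination q * heq
    have h := hx p q hq
    rw [hsub, abs_div, abs_mul, hdet', abs_of_nonneg ht, abs_of_pos hpos, one_mul] at h
    have hle : (t : ℝ) / (q * (q + q' * t)) ≤ t / (q : ℝ) ^ 2 := by
      apply div_le_div_of_nonneg_left ht (by positivity)
      nlinarith
    have h' := h.trans hle
    rwa [div_le_div_iff_of_pos_right (by positivity)] at h'
  have convergents : ∃ p q p' q' : ℤ, 1 ≤ q ∧ 0 ≤ q' ∧ |p' * q - p * q'| = 1 ∧
      (x : ℝ) * (q + q' * (T^[n] x : ℝ)) = p + p' * (T^[n] x : ℝ) := by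
    induction n with
    | zero => exact ⟨0, 1, 1, 0, le_rfl, le_rfl, by norm_num, by simp⟩
    | succ n ih =>
      obtain ⟨p, q, p', q', hq, hq', hdet, heq⟩ := ih
      rw [Function.iterate_succ_apply']
      set t := T^[n] x
      have ht : 0 < (t : ℝ) := hc.trans_le (lower t p q p' q' hq hq' hdet heq)
      have hTt := hT t
      rw [if_neg ht.ne'] at hTt
      have ha : 1 ≤ ⌊1 / (t : ℝ)⌋ := by
        rw [Int.le_floor, Int.cast_one, le_div_iff₀ ht]
        simpa using t.2.2
      have hfl : ((⌊1 / (t : ℝ)⌋ : ℤ) : ℝ) + T t = 1 / t := by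
        rw [hTt]; exact Int.floor_add_fract _
      generalize ⌊1 / (t : ℝ)⌋ = a at ha hfl
      rw [eq_div_iff ht.ne'] at hfl
      refine ⟨p * a + p', q * a + q', p, q, by nlinarith, by linarith, ?_, ?_⟩
      · rw [← hdet, abs_sub_comm]
        congr 1
        ring
      · push_cast
        refine mul_right_cancel₀ ht.ne' ?_
        linear_combination heq + ((x : ℝ) * q - p) * hfl
  obtain ⟨p, q, p', q', hq, hq', hdet, heq⟩ := convergents
  exact lower _ p q p' q' hq hq' hdet heq

/-- For the Gauss map `T` on `[0,1]` (`T 0 = 0`, `T x = 1/x mod 1`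
for `x ≠ 0`), the set `{x : liminf_n |T^n x| > 0}` is `α`-winning for Schmidt's game
on `[0,1]` for every `α ∈ (0, 1/2)`. -/
theorem gaussMap_badly_approximable_schmidt_winning
    (T : Set.Icc (0:ℝ) 1 → Set.Icc (0:ℝ) 1)
    (hT : ∀ x : Set.Icc (0:ℝ) 1,
      ((T x : ℝ)) = if (x : ℝ) = 0 then 0 else Int.fract (1 / (x : ℝ)))
    (α : ℝ) (hα : α ∈ Set.Ioo (0:ℝ) (1/2)) :
    ∀ β ∈ Set.Ioo (0:ℝ) 1,
      SchmidtWinning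
        {x : Set.Icc (0:ℝ) 1 |
          0 < Filter.liminf (fun n => |((T^[n] x : ℝ))|) Filter.atTop}
        α β := by
  intro β hβ
  choose! f hsub hfar using
    fun (z : Set.Icc (0 : ℝ) 1) (r : ℝ) (hr : 0 < r) =>
      exists_closedBall_subset_far_from_fractions hα z r hr
  refine ⟨fun l => (l.getLast?.map fun m => f m.1 m.2).getD 0, ?_⟩
  intro z r hr0 hr hbob
  have last : ∀ k, ((((List.range (k + 1)).map fun i => (z i, r i)).getLast?.map
      fun m => f m.1 m.2).getD 0) = f (z k) (r k) := by
    intro k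
    simp [List.range_succ]
  simp only [last] at hbob ⊢
  have hs : 0 < β * α := mul_pos hβ.1 hα.1
  have hs1 : β * α < 1 := by nlinarith [hβ.2, hα.2, hβ.1, hα.1]
  have hpow : ∀ k, r k = r 0 * (β * α) ^ k := by
    intro k
    induction k with
    | zero => simp
    | succ k ih => rw [hr, ih]; ring
  have hrpos : ∀ k, 0 < r k := fun k => by rw [hpow]; positivity
  refine ⟨fun k => hsub _ _ (hrpos k), ?_⟩
  obtain ⟨x, hx⟩ : (⋂ k, Metric.closedBall (z k) (r k)).Nonempty :=
    IsCompact.nonempty_iInter_of_sequence_nonempty_isCompact_isClosed _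
      (fun k => (hbob k).trans (hsub _ _ (hrpos k)))
      (fun k => Metric.nonempty_closedBall.2 (hrpos k).le)
      (Metric.isClosed_closedBall.isCompact) (fun k => Metric.isClosed_closedBall)
  refine ⟨x, hx, ?_⟩
  rw [Set.mem_iInter] at hx
  have hα' : 0 < 1 - 2 * α := by linarith [hα.2]
  set c := (1 - 2 * α) * min (r 0) (β * α / 8) with hc_def
  have hc : 0 < c := mul_pos hα' (lt_min hr0 (by positivity))
  have hbad : ∀ p q : ℤ, 1 ≤ q → c / (q : ℝ) ^ 2 ≤ |(x : ℝ) - p / q| := by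
    intro p q hq
    have h1 : (1 : ℝ) ≤ q := by exact_mod_cast hq
    have h2 : (1 : ℝ) ≤ (q : ℝ) ^ 2 := one_le_pow₀ h1
    have hex : ∃ k, 8 * (q : ℝ) ^ 2 * r k ≤ 1 := by
      obtain ⟨k, hk⟩ := exists_pow_lt_of_lt_one
        (show 0 < 1 / (8 * (q : ℝ) ^ 2 * r 0) by positivity) hs1
      refine ⟨k, ?_⟩
      rw [lt_div_iff₀ (by positivity)] at hk
      rw [hpow]
      linarith
    classical
    have hfirst := Nat.find_spec hex
    have hmin : ∀ m < Nat.find hex, ¬ 8 * (q : ℝ) ^ 2 * r m ≤ 1 :=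
      fun m hm => Nat.find_min hex hm
    generalize Nat.find hex = k at hfirst hmin
    refine le_trans ?_ (hfar (z k) (r k) (hrpos k) x (hbob k (hx (k + 1))) p q hq hfirst)
    rw [hc_def, mul_div_assoc]
    refine mul_le_mul_of_nonneg_left ?_ hα'.le
    rw [div_le_iff₀ (by positivity)]
    cases k with
    | zero => exact (min_le_left _ _).trans (by nlinarith)
    | succ k =>
      refine (min_le_right _ _).trans ?_
      have h := hmin k k.lt_succ_self
      push Not at h
      rw [hr]
      nlinarith
  have hle : c ≤ Filter.liminf (fun n => |((T^[n] x : ℝ))|) Filter.atTop := by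
    refine Filter.le_liminf_of_le ?_ (Filter.Eventually.of_forall fun n => ?_)
    · refine Filter.IsBoundedUnder.isCoboundedUnder_ge ⟨1, ?_⟩
      rw [Filter.eventually_map]
      refine Filter.Eventually.of_forall fun n => ?_
      rw [abs_of_nonneg (T^[n] x).2.1]
      exact (T^[n] x).2.2
    · exact (le_gaussMap_iterate T hT hc x hbad n).trans (le_abs_self _)
  exact hc.trans_le hle
end

section
/- Let T : (0,1) → [0,1) be the Gauss map T(x) = 1/x mod 1. Let n be a positive integer and let x, y ∈ (0,1) be irrational numbers lying in the same n-th order cylinder, i.e., ⌊1/(T^k x)⌋ = ⌊1/(T^k y)⌋ for all 0 ≤ k < n (the first n continued fraction digits of x and y agree). If T^n has derivative d_x at x and derivative d_y at y, then 1/4 ≤ |d_x|/|d_y| ≤ 4. -/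
theorem hasDerivAt_fract_of_fract_ne_zero {u : ℝ} (hu : Int.fract u ≠ 0) :
    HasDerivAt (Int.fract : ℝ → ℝ) 1 u := by
  have hlt : (⌊u⌋ : ℝ) < u :=
    lt_of_le_of_ne (Int.floor_le u) fun h => hu (by rw [Int.fract, h, sub_self])
  refine ((hasDerivAt_id u).sub_const (⌊u⌋ : ℝ)).congr_of_eventuallyEq ?_
  filter_upwards [Ioo_mem_nhds hlt (Int.lt_floor_add_one u)] with v hv
  have hfloor : ⌊v⌋ = ⌊u⌋ := Int.floor_eq_iff.mpr ⟨hv.1.le, hv.2⟩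
  simp [Int.fract, hfloor]

/-- Irrational points are sent by the Gauss map to irrational points of `(0, 1)`. -/
theorem Irrational.fract_one_div {t : ℝ} (ht : Irrational t) :
    Irrational (Int.fract (1 / t)) ∧ Int.fract (1 / t) ∈ Set.Ioo (0 : ℝ) 1 := by
  have hirr : Irrational (Int.fract (1 / t)) := by
    rw [Int.fract, one_div]
    exact ht.inv.sub_intCast _
  exact ⟨hirr, lt_of_le_of_ne (Int.fract_nonneg _) hirr.ne_zero.symm, Int.fract_lt_one _⟩

theorem hasDerivAt_fract_one_div {t : ℝ} (ht : Irrational t) :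
    HasDerivAt (fun x : ℝ => Int.fract (1 / x)) (-(t ^ 2)⁻¹) t := by
  have hinv : HasDerivAt (fun x : ℝ => 1 / x) (-(t ^ 2)⁻¹) t := by
    simpa only [one_div] using hasDerivAt_inv ht.ne_zero
  have h := (hasDerivAt_fract_of_fract_ne_zero ht.fract_one_div.1.ne_zero).comp t hinv
  rwa [one_mul] at h

theorem irrational_gaussMap_iterate {x : ℝ} (hx : x ∈ Set.Ioo (0 : ℝ) 1) (hxirr : Irrational x)
    (n : ℕ) :
    Irrational ((fun x : ℝ => Int.fract (1 / x))^[n] x) ∧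
      (fun x : ℝ => Int.fract (1 / x))^[n] x ∈ Set.Ioo (0 : ℝ) 1 := by
  induction n with
  | zero => exact ⟨hxirr, hx⟩
  | succ n ih =>
    rw [Function.iterate_succ_apply']
    exact ih.1.fract_one_div

/-- One step of the recursion for the derivative of the iterates of the Gauss map in terms of
the denominators of the convergents. -/
theorem HasDerivAt.gaussMap_comp {f : ℝ → ℝ} {x e a b : ℝ}
    (hf : HasDerivAt f (e * (a + b * f x) ^ 2) x) (hirr : Irrational (f x)) :
    HasDerivAt (fun z => Int.fract (1 / f z))
      (-e * ((a * ⌊1 / f x⌋ + b) + a * Int.fract (1 / f x)) ^ 2) x := by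
  refine ((hasDerivAt_fract_one_div hirr).comp x hf).congr_deriv ?_
  have h0 := hirr.ne_zero
  rw [← Int.self_sub_floor]
  field_simp
  ring

/-- On a cylinder of order `n`, the derivative of the `n`-th iterate `G^[n]` of the Gauss map is
`± (a + b * G^[n] z) ^ 2` at each irrational `z`, where `a ≥ b` are the denominators of the last
two convergents. -/
theorem exists_hasDerivAt_gaussMap_iterate {x y : ℝ}
    (hx : x ∈ Set.Ioo (0 : ℝ) 1) (hy : y ∈ Set.Ioo (0 : ℝ) 1)
    (hxirr : Irrational x) (hyirr : Irrational y) (n : ℕ)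
    (hcyl : ∀ k < n, ⌊1 / (fun x : ℝ => Int.fract (1 / x))^[k] x⌋ =
      ⌊1 / (fun x : ℝ => Int.fract (1 / x))^[k] y⌋) :
    ∃ e a b : ℝ, |e| = 1 ∧ 0 < a ∧ 0 ≤ b ∧ b ≤ a ∧
      HasDerivAt ((fun x : ℝ => Int.fract (1 / x))^[n])
        (e * (a + b * (fun x : ℝ => Int.fract (1 / x))^[n] x) ^ 2) x ∧
      HasDerivAt ((fun x : ℝ => Int.fract (1 / x))^[n])
        (e * (a + b * (fun x : ℝ => Int.fract (1 / x))^[n] y) ^ 2) y := by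
  induction n with
  | zero =>
    refine ⟨1, 1, 0, by simp, one_pos, le_rfl, zero_le_one, ?_, ?_⟩
    · simpa using hasDerivAt_id x
    · simpa using hasDerivAt_id y
  | succ n ih =>
    obtain ⟨e, a, b, he, ha, hb, hba, hdx, hdy⟩ := ih fun k hk => hcyl k (hk.trans n.lt_succ_self)
    obtain ⟨hxi, hx0, hx1⟩ := irrational_gaussMap_iterate hx hxirr n
    obtain ⟨hyi, -, -⟩ := irrational_gaussMap_iterate hy hyirr n
    have hd := hcyl n n.lt_succ_self
    have hdx' := hdx.gaussMap_comp hxi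
    have hdy' := hdy.gaussMap_comp hyi
    rw [← hd] at hdy'
    have hone : (1 : ℝ) ≤ ⌊1 / (fun x : ℝ => Int.fract (1 / x))^[n] x⌋ := by
      exact_mod_cast Int.le_floor.mpr (by simpa using (one_le_div hx0).mpr hx1.le)
    rw [Function.iterate_succ']
    have hle : a ≤ a * ⌊1 / (fun x : ℝ => Int.fract (1 / x))^[n] x⌋ :=
      le_mul_of_one_le_right ha.le hone
    exact ⟨-e, _, a, by rwa [abs_neg], by linarith, ha.le, by linarith, hdx', hdy'⟩

theorem sq_add_mul_le_four_mul_sq {a b s t : ℝ} (ha : 0 ≤ a) (hb : 0 ≤ b) (hba : b ≤ a)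
    (hs : s ∈ Set.Icc (0 : ℝ) 1) (ht : 0 ≤ t) :
    (a + b * s) ^ 2 ≤ 4 * (a + b * t) ^ 2 := by
  have h1 : b * s ≤ b := mul_le_of_le_one_right hb hs.2
  have h2 : 0 ≤ b * s := mul_nonneg hb hs.1
  have h3 : 0 ≤ b * t := mul_nonneg hb ht
  calc (a + b * s) ^ 2 ≤ (2 * (a + b * t)) ^ 2 := by gcongr; linarith
    _ = 4 * (a + b * t) ^ 2 := by ring

/-- **Bounded distortion for the Gauss map.** Let `G` be the Gauss
map, realized as the real function `G x = Int.fract (1 / x)` (with the Lean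
convention `1 / 0 = 0` this gives `G 0 = 0`, so `G` agrees with the Gauss map
`x ↦ 1/x mod 1` on `(0,1)`).  Let `n ≥ 1` and let `x, y ∈ (0,1)` be irrational
numbers lying in the same `n`-th order cylinder, i.e. `⌊1/(G^[k] x)⌋ = ⌊1/(G^[k] y)⌋`
for all `k < n` (their first `n` continued fraction digits agree).  If `G^[n]` has
derivative `dx` at `x` and `dy` at `y`, then `1/4 ≤ |dx|/|dy| ≤ 4`. -/
theorem gaussMap_iterate_bounded_distortion
    (G : ℝ → ℝ) (hG : ∀ x : ℝ, G x = Int.fract (1 / x))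
    (n : ℕ) (hn : 1 ≤ n) (x y : ℝ)
    (hx : x ∈ Set.Ioo (0:ℝ) 1) (hy : y ∈ Set.Ioo (0:ℝ) 1)
    (hxirr : Irrational x) (hyirr : Irrational y)
    (hcyl : ∀ k < n, ⌊1 / G^[k] x⌋ = ⌊1 / G^[k] y⌋)
    (dx dy : ℝ) (hdx : HasDerivAt (G^[n]) dx x) (hdy : HasDerivAt (G^[n]) dy y) :
    1 / 4 ≤ |dx| / |dy| ∧ |dx| / |dy| ≤ 4 := by
  obtain rfl : G = fun x => Int.fract (1 / x) := funext hG
  obtain ⟨e, a, b, he, ha, hb, hba, hdx', hdy'⟩ :=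
    exists_hasDerivAt_gaussMap_iterate hx hy hxirr hyirr n hcyl
  have hs := Set.Ioo_subset_Icc_self (irrational_gaussMap_iterate hx hxirr n).2
  have ht := Set.Ioo_subset_Icc_self (irrational_gaussMap_iterate hy hyirr n).2
  rw [hdx.unique hdx', hdy.unique hdy', abs_mul, abs_mul, he, one_mul, one_mul, abs_sq, abs_sq]
  have hpos : 0 < (a + b * (fun x : ℝ => Int.fract (1 / x))^[n] y) ^ 2 :=
    pow_pos (add_pos_of_pos_of_nonneg ha (mul_nonneg hb ht.1)) 2
  have hxy := sq_add_mul_le_four_mul_sq ha.le hb hba hs ht.1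
  have hyx := sq_add_mul_le_four_mul_sq ha.le hb hba ht hs.1
  rw [le_div_iff₀ hpos, div_le_iff₀ hpos]
  constructor <;> linarith
end
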